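/- Let m ≥ n ≥ 1 be integers, let 𝔽₄ be the field with four elements, and let ω ∈ 𝔽₄ satisfy ω² + ω + 1 = 0 (so ω has multiplicative order 3). Let x ∈ M_{2^m}(𝔽₄) be the nilpotent single Jordan block of size 2^m (1's on the superdiagonal, 0 elsewhere), and set y = ω · x^{2^{m−n}}. Then there do not exist matrices X, Y ∈ M_{2^m}(W₂(𝔽₄)) such that X·Y = Y·X, the entrywise reductions of X and Y under the natural surjection W₂(𝔽₄) → 𝔽₄ equal x and y respectively, (1 + X)^{2^m} = 1, and (1 + Y)^{2^n} = 1. -/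

import Mathlib

/-- The natural reduction ring homomorphism `W₂(k) → k` from length-two `p`-typical
Witt vectors to `k`, given by the zeroth coefficient. -/
noncomputable def wittReduce (p : ℕ) [Fact p.Prime] (k : Type*) [CommRing k] :
    TruncatedWittVector p 2 k →+* k :=
  RingHom.liftOfRightInverse (WittVector.truncate 2) TruncatedWittVector.out
    TruncatedWittVector.truncateFun_out
    ⟨WittVector.constantCoeff, fun x hx => by
      rw [WittVector.mem_ker_truncate] at hx
      simpa [RingHom.mem_ker] using hx 0 (by norm_num)⟩

theorem wittReduce_truncate {p : ℕ} [Fact p.Prime] {k : Type*} [CommRing k] (a : WittVector p k) :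
    wittReduce p k (WittVector.truncate 2 a) = a.coeff 0 :=
  RingHom.liftOfRightInverse_comp_apply (WittVector.truncate 2) TruncatedWittVector.out
    TruncatedWittVector.truncateFun_out _ a

theorem wittReduce_surjective {p : ℕ} [Fact p.Prime] {k : Type*} [CommRing k] :
    Function.Surjective (wittReduce p k) := fun a =>
  ⟨WittVector.truncate 2 (WittVector.teichmuller p a), by
    rw [wittReduce_truncate, WittVector.teichmuller_coeff_zero]⟩

/-- Two length-two Witt vectors in the kernel of the reduction have product zero. -/
theorem mul_eq_zero_of_wittReduce_eq_zero {p : ℕ} [Fact p.Prime] {k : Type*} [CommRing k]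
    [CharP k p] {a b : TruncatedWittVector p 2 k}
    (ha : wittReduce p k a = 0) (hb : wittReduce p k b = 0) : a * b = 0 := by
  obtain ⟨a, rfl⟩ := WittVector.truncate_surjective p 2 k a
  obtain ⟨b, rfl⟩ := WittVector.truncate_surjective p 2 k b
  rw [wittReduce_truncate] at ha hb
  rw [← map_mul, ← RingHom.mem_ker, WittVector.mem_ker_truncate]
  obtain ⟨a, rfl⟩ : ∃ c, a = WittVector.verschiebung c :=
    ⟨_, WittVector.eq_iterate_verschiebung (n := 1) fun i hi => by
      obtain rfl : i = 0 := by omega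
      exact ha⟩
  obtain ⟨b, rfl⟩ : ∃ c, b = WittVector.verschiebung c :=
    ⟨_, WittVector.eq_iterate_verschiebung (n := 1) fun i hi => by
      obtain rfl : i = 0 := by omega
      exact hb⟩
  intro i hi
  rw [← WittVector.verschiebung_mul_frobenius, WittVector.frobenius_verschiebung, ← mul_assoc]
  obtain rfl | rfl : i = 0 ∨ i = 1 := by omega
  · exact WittVector.verschiebung_coeff_zero _
  · rw [show 1 = 0 + 1 from rfl, WittVector.verschiebung_coeff_succ,
      WittVector.mul_charP_coeff_zero]

/-- A length-two Witt vector killed by `p` lies in the kernel of the reduction. -/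
theorem wittReduce_eq_zero_of_mul_natCast_eq_zero {p : ℕ} [Fact p.Prime] {k : Type*} [CommRing k]
    [IsReduced k] [CharP k p] {a : TruncatedWittVector p 2 k} (ha : a * (p : ℕ) = 0) :
    wittReduce p k a = 0 := by
  obtain ⟨a, rfl⟩ := WittVector.truncate_surjective p 2 k a
  rw [← map_natCast (WittVector.truncate 2), ← map_mul, ← RingHom.mem_ker,
    WittVector.mem_ker_truncate] at ha
  have h := ha 1 one_lt_two
  rw [show 1 = 0 + 1 from rfl, WittVector.mul_charP_coeff_succ] at h
  rw [wittReduce_truncate]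
  exact eq_zero_of_pow_eq_zero h

theorem one_add_pow_two_pow_succ {S : Type*} [Ring S] (h4 : (4 : S) = 0) (a : S) (k : ℕ) :
    (1 + a) ^ 2 ^ (k + 1) = 1 + a ^ 2 ^ (k + 1) + 2 * a ^ 2 ^ k := by
  induction k with
  | zero =>
    simp only [zero_add, pow_one, pow_zero]
    noncomm_ring
  | succ k ih =>
    rw [pow_succ 2 (k + 1), pow_mul, ih, pow_mul a, pow_succ 2 k, pow_mul a]
    generalize a ^ 2 ^ k = b
    have : (1 + b ^ 2 + 2 * b) ^ 2 =
        1 + (b ^ 2) ^ 2 + 2 * b ^ 2 + 4 * (b ^ 2 + b + b ^ 3) := by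
      noncomm_ring
    rw [this, h4, zero_mul, add_zero]

theorem Matrix.superdiagonal_pow_apply {k : Type*} [CommRing k] {N : ℕ} (r : ℕ) (i j : Fin N) :
    ((Matrix.of fun i j : Fin N => if (i : ℕ) + 1 = j then (1 : k) else 0) ^ r) i j =
      if (i : ℕ) + r = j then 1 else 0 := by
  induction r generalizing i with
  | zero => simp [Matrix.one_apply, Fin.ext_iff]
  | succ r ih =>
    simp only [pow_succ', Matrix.mul_apply, ih, Matrix.of_apply, ite_mul, one_mul, zero_mul]
    by_cases hi : (i : ℕ) + 1 < N
    · rw [Finset.sum_eq_single ⟨i + 1, hi⟩]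
      · simp [add_assoc, add_comm 1 r]
      · intro b _ hb
        rw [if_neg]
        exact fun h => hb (Fin.ext h.symm)
      · simp
    · rw [Finset.sum_eq_zero, if_neg]
      · have := j.isLt
        omega
      · intro b _
        rw [if_neg]
        have := b.isLt
        omega

/-- with `x` the nilpotent single Jordan block of size `2^m` over `𝔽₄` and
`y = ω·x^{2^{m-n}}` (`ω` of order 3), there are no commuting lifts `X, Y` of `x, y` to
`W₂(𝔽₄)` with `(1+X)^{2^m} = 1` and `(1+Y)^{2^n} = 1`. -/
theorem no_commuting_witt_lifts (m n : ℕ) (hn : 1 ≤ n) (hmn : n ≤ m)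
    (ω : GaloisField 2 2) (hω : ω ^ 2 + ω + 1 = 0)
    (x y : Matrix (Fin (2 ^ m)) (Fin (2 ^ m)) (GaloisField 2 2))
    (hx : x = Matrix.of fun (i j : Fin (2 ^ m)) => if (i : ℕ) + 1 = (j : ℕ) then 1 else 0)
    (hy : y = ω • x ^ (2 ^ (m - n))) :
    ¬ ∃ X Y : Matrix (Fin (2 ^ m)) (Fin (2 ^ m)) (TruncatedWittVector 2 2 (GaloisField 2 2)),
        X * Y = Y * X ∧
        X.map (wittReduce 2 (GaloisField 2 2)) = x ∧
        Y.map (wittReduce 2 (GaloisField 2 2)) = y ∧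
        (1 + X) ^ (2 ^ m) = 1 ∧ (1 + Y) ^ (2 ^ n) = 1 := by
  rintro ⟨X, Y, hXY, hX, hY, hX1, hY1⟩
  obtain ⟨n, rfl⟩ : ∃ l, n = l + 1 := ⟨n - 1, by omega⟩
  obtain ⟨m, rfl⟩ : ∃ l, m = l + 1 := ⟨m - 1, by omega⟩
  obtain ⟨w, hw⟩ := wittReduce_surjective (p := 2) ω
  let φ := (wittReduce 2 (GaloisField 2 2)).mapMatrix (m := Fin (2 ^ (m + 1)))
  have mul_zero_of_ker : ∀ {A B}, φ A = 0 → φ B = 0 → A * B = 0 := by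
    intro A B hA hB
    ext1 i j
    rw [Matrix.mul_apply]
    exact Finset.sum_eq_zero fun l _ => mul_eq_zero_of_wittReduce_eq_zero
      (congrFun (congrFun hA i) l) (congrFun (congrFun hB l) j)
  have ker_of_mul_two : ∀ {A}, A * 2 = 0 → φ A = 0 := by
    intro A hA
    ext1 i j
    refine wittReduce_eq_zero_of_mul_natCast_eq_zero ?_
    have := congrFun (congrFun hA i) j
    rw [mul_two] at this
    rw [Nat.cast_two, mul_two]
    exact this
  have hφ2 : φ 2 = 0 := by
    rw [map_ofNat]
    exact CharTwo.two_eq_zero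
  have h4 : (4 : Matrix (Fin (2 ^ (m + 1))) (Fin (2 ^ (m + 1)))
      (TruncatedWittVector 2 2 (GaloisField 2 2))) = 0 := by
    rw [← mul_zero_of_ker hφ2 hφ2]
    norm_num
  replace hX : φ X = x := hX
  replace hY : φ Y = y := hY
  rw [one_add_pow_two_pow_succ h4, add_assoc, add_eq_left] at hX1 hY1
  set P := w • X ^ 2 ^ (m + 1 - (n + 1)) with hP
  have hφsmul : ∀ (c : TruncatedWittVector 2 2 (GaloisField 2 2)) (A),
      φ (c • A) = wittReduce 2 _ c • φ A := by
    intro c A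
    ext1 i j
    exact map_mul (wittReduce 2 (GaloisField 2 2)) _ _
  have hφP : φ P = y := by
    rw [hP, hφsmul, map_pow, hX, hw, hy]
  have hD : φ (Y - P) = 0 := by rw [map_sub, hY, hφP, sub_self]
  have hPY : Commute P Y := ((show Commute X Y from hXY).pow_left _).smul_left w
  have hsq : Y ^ 2 = P ^ 2 := by
    have h1 := mul_zero_of_ker hD hD
    have h2 := mul_zero_of_ker hφ2 hD
    have h3 : Y ^ 2 - P ^ 2 = (Y - P) * (Y - P) + 2 * (Y - P) * P := by
      have := hPY.eq
      noncomm_ring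
      rw [this]
      abel
    rwa [h1, h2, zero_mul, add_zero, sub_eq_zero] at h3
  have hpow : Y ^ 2 ^ (n + 1) = w ^ 2 ^ (n + 1) • X ^ 2 ^ (m + 1) := by
    rw [pow_succ' 2 n, pow_mul, hsq, ← pow_mul, ← pow_succ' 2 n, hP, smul_pow, ← pow_mul,
      ← pow_add]
    congr 3
    omega
  have hkey : (w ^ 2 ^ (n + 1) • X ^ 2 ^ m - Y ^ 2 ^ n) * 2 = 0 := by
    have hX2 := eq_neg_of_add_eq_zero_left hX1
    have hY2 := eq_neg_of_add_eq_zero_left hY1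
    rw [hpow, hX2, smul_neg, neg_inj] at hY2
    rw [two_mul, two_mul, smul_add] at hY2
    rw [mul_two, sub_add_sub_comm, hY2, sub_self]
  have h := ker_of_mul_two hkey
  rw [map_sub, hφsmul, map_pow, map_pow, map_pow, hX, hY, hw, hy, smul_pow, ← pow_mul,
    ← pow_add, show m + 1 - (n + 1) + n = m by omega, sub_eq_zero] at h
  have hm : 2 ^ m < 2 ^ (m + 1) := Nat.pow_lt_pow_right one_lt_two (Nat.lt_succ_self m)
  have he := congrFun (congrFun h ⟨0, by positivity⟩) ⟨2 ^ m, hm⟩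
  simp only [Matrix.smul_apply, hx, Matrix.superdiagonal_pow_apply, zero_add, if_true,
    smul_eq_mul, mul_one] at he
  have hω2 : ω ^ 2 = ω := by
    rw [pow_succ' 2 n, pow_mul] at he
    exact iterateFrobenius_inj (GaloisField 2 2) 2 n he
  rw [hω2, CharTwo.add_self_eq_zero, zero_add] at hω
  exact one_ne_zero hω
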